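/- arXiv:2601.15332 — 2 statements merged into one kernel-verified Lean document; each statement's English description precedes it below -/
import Mathlib

section
/- Let φ : ℝ → ℝ be a cognitive-cost function with φ(0) = 0 that is monotone increasing on [0,∞) and strictly convex on [0,∞). Then for every natural number k ≥ 2, k · φ(2) < φ(2^k); that is, evaluating n = 2^k alternatives in k binary stages incurs strictly smaller total attention cost than evaluating all 2^k alternatives simultaneously. -/
/-- A strictly convex function on `[0, ∞)` vanishing at `0` is strictly superhomogeneous. -/
theorem StrictConvexOn.mul_lt_map_mul {f : ℝ → ℝ} (hf : StrictConvexOn ℝ (Set.Ici (0 : ℝ)) f)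
    (h0 : f 0 = 0) {c x : ℝ} (hc : 1 < c) (hx : 0 < x) : c * f x < f (c * x) := by
  have hc0 : 0 < c := zero_lt_one.trans hc
  have hcx : 0 < c * x := mul_pos hc0 hx
  have h := hf.2 (Set.mem_Ici.2 le_rfl) (Set.mem_Ici.2 hcx.le) hcx.ne
    (sub_pos.2 (inv_lt_one_of_one_lt₀ hc)) (inv_pos.2 hc0) (sub_add_cancel 1 c⁻¹)
  simp only [smul_eq_mul, mul_zero, zero_add, h0, inv_mul_cancel_left₀ hc0.ne'] at h
  rwa [lt_inv_mul_iff₀ hc0] at h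

/-- **Sequential Choice Reduces Expected Cognitive Cost.** If the attention-cost
function `φ` satisfies `φ(0) = 0`, is monotone increasing on `[0,∞)` and strictly convex
on `[0,∞)`, then for every `k ≥ 2`, evaluating `2^k` alternatives in `k` binary stages
costs strictly less than a one-shot evaluation: `k · φ(2) < φ(2^k)`. -/
theorem sequential_reduces_cognitive_cost
    (φ : ℝ → ℝ) (hφ0 : φ 0 = 0)
    (hmono : MonotoneOn φ (Set.Ici (0 : ℝ)))
    (hconv : StrictConvexOn ℝ (Set.Ici (0 : ℝ)) φ)
    (k : ℕ) (hk : 2 ≤ k) :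
    (k : ℝ) * φ 2 < φ (2 ^ k) := by
  obtain ⟨n, rfl⟩ : ∃ n, k = n + 1 := ⟨k - 1, by omega⟩
  have hφ2 : 0 ≤ φ 2 :=
    hφ0 ▸ hmono (Set.mem_Ici.2 le_rfl) (Set.mem_Ici.2 zero_le_two) zero_le_two
  have hn : ((n + 1 : ℕ) : ℝ) ≤ 2 ^ n := by
    exact_mod_cast Nat.succ_le_of_lt n.lt_two_pow_self
  calc ((n + 1 : ℕ) : ℝ) * φ 2 ≤ 2 ^ n * φ 2 := mul_le_mul_of_nonneg_right hn hφ2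
    _ < φ (2 ^ n * 2) :=
      hconv.mul_lt_map_mul hφ0 (one_lt_pow₀ one_lt_two (by omega)) two_pos
    _ = φ (2 ^ (n + 1)) := by rw [pow_succ]
end

section
/- There exist a three-element linearly ordered set X = {x*, y, z} with maximum x* and a monotonic attention rule μ on X such that the sequential architecture strictly outperforms the simultaneous one: π(x*|{x*,y}) · π(x*|{x*,z}) > π(x*|X), where π is the RAM choice rule induced by μ. In particular, sequential and simultaneous choice probabilities of the utility-maximizing alternative can strictly diverge under bounded (non-full) attention. -/
open Finset

/-- An attention rule on a finite linearly ordered set `X`: `μ T S` is the probability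
of attending to the consideration set `T` when the choice set `S` is offered. -/
def IsAttentionRule {X : Type*} [Fintype X] [LinearOrder X]
    (μ : Finset X → Finset X → ℝ) : Prop :=
  (∀ T S : Finset X, 0 ≤ μ T S) ∧
  (∀ T S : Finset X, ¬(T.Nonempty ∧ T ⊆ S) → μ T S = 0) ∧
  (∀ S : Finset X, S.Nonempty →
    ∑ T ∈ S.powerset.filter (fun T => T.Nonempty), μ T S = 1)

/-- Monotonic attention: removing a non-considered alternative `a ∈ S \ T` weakly
increases the attention probability of `T`. -/
def MonotonicAttention {X : Type*} [Fintype X] [LinearOrder X]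
    (μ : Finset X → Finset X → ℝ) : Prop :=
  ∀ (T S : Finset X) (a : X), T ⊆ S → a ∈ S → a ∉ T → μ T S ≤ μ T (S.erase a)

/-- The RAM choice rule induced by an attention rule `μ`:
`π(x|S) = Σ_{∅ ≠ T ⊆ S, max_≻ T = x} μ(T|S)`. -/
def ramChoice {X : Type*} [Fintype X] [LinearOrder X]
    (μ : Finset X → Finset X → ℝ) (x : X) (S : Finset X) : ℝ :=
  ∑ T ∈ S.powerset.filter (fun T => T.max = (x : WithBot X)), μ T S

/-- The deterministic attention rule that considers exactly `f S` when `S` is offered. -/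
def filterAttention {X : Type*} [LinearOrder X] (f : Finset X → Finset X)
    (T S : Finset X) : ℝ :=
  if T.Nonempty ∧ T = f S then 1 else 0

theorem isAttentionRule_filterAttention {X : Type*} [Fintype X] [LinearOrder X]
    {f : Finset X → Finset X} (hsub : ∀ S, f S ⊆ S)
    (hne : ∀ S : Finset X, S.Nonempty → (f S).Nonempty) :
    IsAttentionRule (filterAttention f) := by
  refine ⟨fun T S => ?_, fun T S h => ?_, fun S hS => ?_⟩
  · unfold filterAttention
    split_ifs <;> norm_num
  · refine if_neg ?_
    rintro ⟨hT, rfl⟩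
    exact h ⟨hT, hsub S⟩
  · rw [Finset.sum_eq_single_of_mem (f S) (by simp [hsub, hne S hS])]
    · exact if_pos ⟨hne S hS, rfl⟩
    · intro T _ hT
      exact if_neg fun h => hT h.2

/-- A deterministic attention rule is monotonic as soon as its consideration mapping is an
attention filter: removing an unconsidered alternative leaves the consideration set unchanged. -/
theorem monotonicAttention_filterAttention {X : Type*} [Fintype X] [LinearOrder X]
    {f : Finset X → Finset X} (hf : ∀ S, ∀ a ∈ S, a ∉ f S → f (S.erase a) = f S) :
    MonotonicAttention (filterAttention f) := by
  intro T S a _ haS haT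
  unfold filterAttention
  split_ifs with h h'
  · exact le_rfl
  · exact absurd ⟨h.1, h.2.trans (hf S a haS (h.2 ▸ haT)).symm⟩ h'
  · exact zero_le_one
  · exact le_rfl

theorem ramChoice_filterAttention_of_max_eq {X : Type*} [Fintype X] [LinearOrder X]
    {f : Finset X → Finset X} {x : X} {S : Finset X} (hsub : f S ⊆ S)
    (hmax : (f S).max = (x : WithBot X)) :
    ramChoice (filterAttention f) x S = 1 := by
  unfold ramChoice
  rw [Finset.sum_eq_single_of_mem (f S) (by simp [hsub, hmax])]
  · exact if_pos ⟨⟨x, Finset.mem_of_max hmax⟩, rfl⟩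
  · intro T _ hT
    exact if_neg fun h => hT h.2

theorem ramChoice_filterAttention_of_max_ne {X : Type*} [Fintype X] [LinearOrder X]
    {f : Finset X → Finset X} {x : X} {S : Finset X}
    (hmax : (f S).max ≠ (x : WithBot X)) :
    ramChoice (filterAttention f) x S = 0 := by
  refine Finset.sum_eq_zero fun T hT => if_neg ?_
  rintro ⟨-, rfl⟩
  exact hmax (Finset.mem_filter.mp hT).2

/-- The attention filter that overlooks the best alternative exactly when all three alternatives
are offered. -/
def overlookBest (S : Finset (Fin 3)) : Finset (Fin 3) :=
  if S = Finset.univ then {0, 1} else S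

theorem overlookBest_subset : ∀ S, overlookBest S ⊆ S := by decide

/-- **Sequential Choice Divergence / Strict Sequential Advantage.** On the three-element
linearly ordered set `X = Fin 3 = {x*, y, z}` with maximum `x* = 2` (and `y = 1`,
`z = 0`), there exists a monotonic attention rule `μ` under which the sequential
architecture strictly outperforms the simultaneous one:
`π(x*|{x*,y}) · π(x*|{x*,z}) > π(x*|X)`.  In particular, sequential and simultaneous
choice probabilities of the utility-maximizing alternative strictly diverge under
bounded (non-full) attention. -/
theorem sequential_choice_divergence :
    ∃ μ : Finset (Fin 3) → Finset (Fin 3) → ℝ,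
      IsAttentionRule μ ∧ MonotonicAttention μ ∧
      ramChoice μ 2 {2, 1} * ramChoice μ 2 {2, 0} >
        ramChoice μ 2 (Finset.univ : Finset (Fin 3)) := by
  refine ⟨filterAttention overlookBest,
    isAttentionRule_filterAttention overlookBest_subset (by decide),
    monotonicAttention_filterAttention (by decide), ?_⟩
  rw [ramChoice_filterAttention_of_max_eq (overlookBest_subset _) (by decide),
    ramChoice_filterAttention_of_max_eq (overlookBest_subset _) (by decide),
    ramChoice_filterAttention_of_max_ne (by decide)]
  norm_num
end
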